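/- Let A_{ij;k}(x_{ij},x_{ik},x_{jk}) = α_{ij;k} x_{ik} x_{jk} + β^{(i)}_{ij;k} x_{ij} x_{ik} + β^{(j)}_{ij;k} x_{ij} x_{jk} + λ_{ij;k} x_{ij}² + μ^{(i)}_{ij;k} x_{ik}² + μ^{(j)}_{ij;k} x_{jk}² be a family of quadratic polynomials over ℂ indexed by labels (ij;k) with i,j,k ∈ {1,2,3,4}, and suppose α_{ij;k} ≠ 0 and λ_{ij;k} = 0 for all labels. Then the family satisfies the system (A2) if and only if β^{(i)}_{ij;k} = β^{(j)}_{ij;k} = 0 and μ^{(i)}_{ij;k} = μ^{(j)}_{ij;k} = 0 for all labels, and there exist nonzero complex constants c_{ij} = c_{ji} (1 ≤ i < j ≤ 4) such that α_{ij;k} = c_{ik} c_{jk} / c_{ij} for all labels. -/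

import Mathlib

/- Statement 4 (case (I)): for quadratic families with `α_{ij;k} ≠ 0` and `λ_{ij;k} = 0`,
   the system (A2) holds iff all `β` and `μ` coefficients vanish and
   `α_{ij;k} = c_{ik} c_{jk} / c_{ij}` for some nonzero constants `c_{ij} = c_{ji}`. -/

noncomputable section

open MvPolynomial

/-- The variable index of `x_{ij} = x_{ji}`: the sorted pair. -/
def vd (i j : Fin 4) : Fin 4 × Fin 4 := if i ≤ j then (i, j) else (j, i)

/-- The variable `x_{ij}` in the polynomial ring in the six variables `x_{pq}`. -/
def xv (i j : Fin 4) : MvPolynomial (Fin 4 × Fin 4) ℂ := X (vd i j)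

/-- The quadratic polynomial `A_{ij;k}`, written out in the six variables `x_{pq}`.
    Here `β i j k` denotes `β^{(i)}_{ij;k}` and `μ i j k` denotes `μ^{(i)}_{ij;k}`;
    the symmetry convention `A_{ij;k} = A_{ji;k}` then swaps the superscripts. -/
def quadA (α β lam μ : Fin 4 → Fin 4 → Fin 4 → ℂ) (i j k : Fin 4) :
    MvPolynomial (Fin 4 × Fin 4) ℂ :=
  C (α i j k) * xv i k * xv j k + C (β i j k) * xv i j * xv i k +
    C (β j i k) * xv i j * xv j k + C (lam i j k) * xv i j ^ 2 +
    C (μ i j k) * xv i k ^ 2 + C (μ j i k) * xv j k ^ 2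

/-- The system (A2), as an identity in the six variables `x_{pq}`,
    for every `{i,j,k,ℓ} = {1,2,3,4}`. -/
def SystemA2 (A : Fin 4 → Fin 4 → Fin 4 → MvPolynomial (Fin 4 × Fin 4) ℂ) : Prop :=
  ∀ i j k l : Fin 4, ({i, j, k, l} : Finset (Fin 4)) = Finset.univ →
    pderiv (vd i j) (A i j k) * A i j l + pderiv (vd i k) (A i j k) * A i k l +
        pderiv (vd j k) (A i j k) * A j k l =
      pderiv (vd i j) (A i j l) * A i j k + pderiv (vd i l) (A i j l) * A i l k +
        pderiv (vd j l) (A i j l) * A j l k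

theorem vd_comm (i j : Fin 4) : vd i j = vd j i := by
  revert i j; decide

theorem xv_comm (i j : Fin 4) : xv i j = xv j i := by
  rw [xv, vd_comm, xv]

theorem vd_ne_of_ne_right {i j k : Fin 4} (hjk : j ≠ k) : vd i j ≠ vd i k := by
  revert i j k; decide

theorem insert_eq_univ_iff (i j k l : Fin 4) :
    ({i, j, k, l} : Finset (Fin 4)) = Finset.univ ↔
      i ≠ j ∧ i ≠ k ∧ i ≠ l ∧ j ≠ k ∧ j ≠ l ∧ k ≠ l := by
  revert i j k l; decide

section Derivatives

variable (α β lam μ : Fin 4 → Fin 4 → Fin 4 → ℂ) {i j k : Fin 4}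

theorem pderiv_quadA_base (hik : i ≠ k) (hjk : j ≠ k) (hlam : lam i j k = 0) :
    pderiv (vd i j) (quadA α β lam μ i j k) =
      C (β i j k) * xv i k + C (β j i k) * xv j k := by
  have h₁ : vd i k ≠ vd i j := vd_ne_of_ne_right hjk.symm
  have h₂ : vd j k ≠ vd i j := by rw [vd_comm i j]; exact vd_ne_of_ne_right hik.symm
  simp [quadA, xv, pderiv_X_of_ne h₁, pderiv_X_of_ne h₂, hlam,
    Derivation.leibniz, Derivation.leibniz_pow]
  ring

theorem pderiv_quadA_left (hij : i ≠ j) (hjk : j ≠ k) :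
    pderiv (vd i k) (quadA α β lam μ i j k) =
      C (α i j k) * xv j k + C (β i j k) * xv i j + 2 * C (μ i j k) * xv i k := by
  have h₁ : vd i j ≠ vd i k := vd_ne_of_ne_right hjk
  have h₂ : vd j k ≠ vd i k := by
    rw [vd_comm i k, vd_comm j k]; exact vd_ne_of_ne_right hij.symm
  simp [quadA, xv, pderiv_X_of_ne h₁, pderiv_X_of_ne h₂,
    Derivation.leibniz, Derivation.leibniz_pow]
  ring

theorem quadA_swap (hα : α i j k = α j i k) (hlam : lam i j k = lam j i k) :
    quadA α β lam μ i j k = quadA α β lam μ j i k := by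
  simp only [quadA, hα, hlam, xv_comm i j]
  ring

theorem pderiv_quadA_right (hij : i ≠ j) (hik : i ≠ k)
    (hα : α i j k = α j i k) (hlam : lam i j k = lam j i k) :
    pderiv (vd j k) (quadA α β lam μ i j k) =
      C (α i j k) * xv i k + C (β j i k) * xv i j + 2 * C (μ j i k) * xv j k := by
  rw [quadA_swap α β lam μ hα hlam, pderiv_quadA_left α β lam μ hij.symm hik, hα, xv_comm i j]

end Derivatives

/-- Six prescribed values can be attained at the six variables. -/
theorem exists_values {i j k l : Fin 4} (hij : i ≠ j) (hik : i ≠ k) (hil : i ≠ l)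
    (hjk : j ≠ k) (hjl : j ≠ l) (hkl : k ≠ l) (u a b c d e : ℂ) :
    ∃ f : Fin 4 × Fin 4 → ℂ, f (vd i j) = u ∧ f (vd i k) = a ∧ f (vd j k) = b ∧
      f (vd i l) = c ∧ f (vd j l) = d ∧ f (vd k l) = e := by
  have key : ∀ i j k l : Fin 4, i ≠ j → i ≠ k → i ≠ l → j ≠ k → j ≠ l → k ≠ l →
      [vd i j, vd i k, vd j k, vd i l, vd j l, vd k l].Nodup := by decide
  have h := key i j k l hij hik hil hjk hjl hkl
  simp only [List.nodup_cons, List.mem_cons, not_or, List.not_mem_nil] at h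
  refine ⟨fun p => if p = vd i j then u else if p = vd i k then a else if p = vd j k then b
    else if p = vd i l then c else if p = vd j l then d else e, ?_⟩
  simp [h, Ne.symm]

section Forward

variable {α β lam μ : Fin 4 → Fin 4 → Fin 4 → ℂ}

theorem eval_systemA2 (hα : ∀ i j k, α i j k = α j i k)
    (hlam : ∀ i j k : Fin 4, i ≠ j → i ≠ k → j ≠ k → lam i j k = 0)
    (h : SystemA2 (quadA α β lam μ)) {i j k l : Fin 4} (hij : i ≠ j) (hik : i ≠ k)
    (hil : i ≠ l) (hjk : j ≠ k) (hjl : j ≠ l) (hkl : k ≠ l) (u a b c d e : ℂ) :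
    (β i j k * a + β j i k * b) *
        (α i j l * c * d + β i j l * u * c + β j i l * u * d + μ i j l * c ^ 2 +
          μ j i l * d ^ 2) +
      (α i j k * b + β i j k * u + 2 * μ i j k * a) *
        (α i k l * c * e + β i k l * a * c + β k i l * a * e + μ i k l * c ^ 2 +
          μ k i l * e ^ 2) +
      (α i j k * a + β j i k * u + 2 * μ j i k * b) *
        (α j k l * d * e + β j k l * b * d + β k j l * b * e + μ j k l * d ^ 2 +
          μ k j l * e ^ 2) =
    (β i j l * c + β j i l * d) *
        (α i j k * a * b + β i j k * u * a + β j i k * u * b + μ i j k * a ^ 2 +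
          μ j i k * b ^ 2) +
      (α i j l * d + β i j l * u + 2 * μ i j l * c) *
        (α i l k * a * e + β i l k * c * a + β l i k * c * e + μ i l k * a ^ 2 +
          μ l i k * e ^ 2) +
      (α i j l * c + β j i l * u + 2 * μ j i l * d) *
        (α j l k * b * e + β j l k * d * b + β l j k * d * e + μ j l k * b ^ 2 +
          μ l j k * e ^ 2) := by
  obtain ⟨f, hu, ha, hb, hc, hd, he⟩ := exists_values hij hik hil hjk hjl hkl u a b c d e
  have h₁ := h i j k l ((insert_eq_univ_iff i j k l).2 ⟨hij, hik, hil, hjk, hjl, hkl⟩)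
  have hlam' : ∀ {p q r : Fin 4}, p ≠ q → p ≠ r → q ≠ r → lam p q r = lam q p r :=
    fun hpq hpr hqr => by rw [hlam _ _ _ hpq hpr hqr, hlam _ _ _ hpq.symm hqr hpr]
  rw [pderiv_quadA_base α β lam μ hik hjk (hlam _ _ _ hij hik hjk),
    pderiv_quadA_base α β lam μ hil hjl (hlam _ _ _ hij hil hjl),
    pderiv_quadA_left α β lam μ hij hjk, pderiv_quadA_left α β lam μ hij hjl,
    pderiv_quadA_right α β lam μ hij hik (hα _ _ _) (hlam' hij hik hjk),
    pderiv_quadA_right α β lam μ hij hil (hα _ _ _) (hlam' hij hil hjl)] at h₁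
  have h₂ := congrArg (eval f) h₁
  simp only [quadA, xv, map_add, map_mul, map_pow, map_ofNat, eval_C, eval_X, vd_comm l k, hu, ha,
    hb, hc, hd, he, hlam i j k hij hik hjk, hlam i j l hij hil hjl, hlam i k l hik hil hkl,
    hlam j k l hjk hjl hkl, hlam i l k hil hik hkl.symm, hlam j l k hjl hjk hkl.symm] at h₂
  linear_combination h₂

theorem beta_eq_of_systemA2 (hα : ∀ i j k, α i j k = α j i k)
    (hα0 : ∀ i j k : Fin 4, i ≠ j → i ≠ k → j ≠ k → α i j k ≠ 0)
    (hlam : ∀ i j k : Fin 4, i ≠ j → i ≠ k → j ≠ k → lam i j k = 0)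
    (h : SystemA2 (quadA α β lam μ)) {i j k l : Fin 4} (hij : i ≠ j) (hik : i ≠ k)
    (hil : i ≠ l) (hjk : j ≠ k) (hjl : j ≠ l) (hkl : k ≠ l) :
    β i k l = β i j l := by
  have E := fun a b c => eval_systemA2 hα hlam h hij hik hil hjk hjl hkl 0 a b c 0 0
  apply mul_left_cancel₀ (hα0 i j k hij hik hjk)
  linear_combination (E 1 1 1 - E 1 1 (-1) - E 1 (-1) 1 + E 1 (-1) (-1) - E (-1) 1 1
    + E (-1) 1 (-1) + E (-1) (-1) 1 - E (-1) (-1) (-1)) / 8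

theorem beta_add_eq_zero_of_systemA2 (hα : ∀ i j k, α i j k = α j i k)
    (hα0 : ∀ i j k : Fin 4, i ≠ j → i ≠ k → j ≠ k → α i j k ≠ 0)
    (hlam : ∀ i j k : Fin 4, i ≠ j → i ≠ k → j ≠ k → lam i j k = 0)
    (h : SystemA2 (quadA α β lam μ)) {i j k l : Fin 4} (hij : i ≠ j) (hik : i ≠ k)
    (hil : i ≠ l) (hjk : j ≠ k) (hjl : j ≠ l) (hkl : k ≠ l) :
    β k i l + β k j l = 0 := by
  have E := fun a b e => eval_systemA2 hα hlam h hij hik hil hjk hjl hkl 0 a b 0 0 e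
  apply mul_left_cancel₀ (hα0 i j k hij hik hjk)
  linear_combination (E 1 1 1 - E 1 1 (-1) - E 1 (-1) 1 + E 1 (-1) (-1) - E (-1) 1 1
    + E (-1) 1 (-1) + E (-1) (-1) 1 - E (-1) (-1) (-1)) / 8

theorem alpha_mul_eq_of_systemA2 (hα : ∀ i j k, α i j k = α j i k)
    (hlam : ∀ i j k : Fin 4, i ≠ j → i ≠ k → j ≠ k → lam i j k = 0)
    (h : SystemA2 (quadA α β lam μ)) {i j k l : Fin 4} (hij : i ≠ j) (hik : i ≠ k)
    (hil : i ≠ l) (hjk : j ≠ k) (hjl : j ≠ l) (hkl : k ≠ l) :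
    α i j k * α i k l = α i j l * α j l k := by
  have E := fun b c e => eval_systemA2 hα hlam h hij hik hil hjk hjl hkl 0 0 b c 0 e
  linear_combination (E 1 1 1 - E 1 1 (-1) - E 1 (-1) 1 + E 1 (-1) (-1) - E (-1) 1 1
    + E (-1) 1 (-1) + E (-1) (-1) 1 - E (-1) (-1) (-1)) / 8

theorem exists_fourth {i j k : Fin 4} : ∃ l, i ≠ l ∧ j ≠ l ∧ k ≠ l := by
  revert i j k; decide

theorem beta_eq_zero_of_systemA2 (hα : ∀ i j k, α i j k = α j i k)
    (hα0 : ∀ i j k : Fin 4, i ≠ j → i ≠ k → j ≠ k → α i j k ≠ 0)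
    (hlam : ∀ i j k : Fin 4, i ≠ j → i ≠ k → j ≠ k → lam i j k = 0)
    (h : SystemA2 (quadA α β lam μ)) {i j k : Fin 4} (hij : i ≠ j) (hik : i ≠ k)
    (hjk : j ≠ k) : β i j k = 0 := by
  obtain ⟨l, hil, hjl, hkl⟩ := exists_fourth (i := i) (j := j) (k := k)
  have h₁ := beta_eq_of_systemA2 hα hα0 hlam h hij hil hik hjl hjk hkl.symm
  have h₂ := beta_add_eq_zero_of_systemA2 hα hα0 hlam h hjl hij.symm hjk hil.symm hkl.symm hik
  linear_combination (h₂ - h₁) / 2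

theorem mu_eq_zero_of_systemA2 (hα : ∀ i j k, α i j k = α j i k)
    (hα0 : ∀ i j k : Fin 4, i ≠ j → i ≠ k → j ≠ k → α i j k ≠ 0)
    (hlam : ∀ i j k : Fin 4, i ≠ j → i ≠ k → j ≠ k → lam i j k = 0)
    (h : SystemA2 (quadA α β lam μ)) {i j k : Fin 4} (hij : i ≠ j) (hik : i ≠ k)
    (hjk : j ≠ k) : μ i j k = 0 := by
  obtain ⟨l, hil, hjl, hkl⟩ := exists_fourth (i := i) (j := j) (k := k)
  have E := fun b => eval_systemA2 hα hlam h hil hij hik hjl.symm hkl.symm hjk 0 0 b 1 0 0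
  have hβ := beta_eq_zero_of_systemA2 hα hα0 hlam h hil.symm hjl.symm hij
  apply mul_left_cancel₀ (hα0 i l j hil hij hjl.symm)
  linear_combination (E 1 - E (-1)) / 2 - μ i l k * hβ

end Forward

section Factorization

variable {α : Fin 4 → Fin 4 → Fin 4 → ℂ}

/-- The value forced on `c j k ^ 2` by one triangle through the edge `j k` agrees with the value
forced by the other one. -/
theorem edge_sq_eq (hα : ∀ i j k, α i j k = α j i k)
    (hα0 : ∀ i j k : Fin 4, i ≠ j → i ≠ k → j ≠ k → α i j k ≠ 0)
    (hmul : ∀ i j k l : Fin 4, i ≠ j → i ≠ k → i ≠ l → j ≠ k → j ≠ l → k ≠ l →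
      α i j k * α i k l = α i j l * α j l k)
    {i j k l : Fin 4} (hij : i ≠ j) (hik : i ≠ k) (hil : i ≠ l) (hjk : j ≠ k) (hjl : j ≠ l)
    (hkl : k ≠ l) : α i j k * α i k j = α l j k * α l k j := by
  have h₁ : α i k j * α j k l = α k i l * α i l j := by
    simpa only [hα k i j, hα k j l] using hmul k i j l hik.symm hjk.symm hkl hij hil hjl
  have h₂ : α i j k * α j k l = α j i l * α i l k := by
    simpa only [hα j i k] using hmul j i k l hij.symm hjk hjl hik hil hkl
  have h₃ : α l k j * α j k i = α k l i * α i l j := by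
    simpa only [hα k l j, hα k j i, hα l i j] using
      hmul k l j i hkl hjk.symm hik.symm hjl.symm hil.symm hij.symm
  have h₄ : α l j k * α j k i = α j l i * α i l k := by
    simpa only [hα j l k, hα l i k] using
      hmul j l k i hjl hjk hij.symm hkl.symm hil.symm hik.symm
  have h₅ : α j k i * α j i l = α j k l * α k l i :=
    hmul j k i l hjk hij.symm hjl hik.symm hkl hil
  have h₆ : α j k i * α k i l = α j k l * α j l i := by
    simpa only [hα k j i, hα k j l] using hmul k j i l hjk.symm hik.symm hkl hij.symm hjl hil
  have hne : (α j k l * α j k i) ^ 2 ≠ 0 :=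
    pow_ne_zero 2 (mul_ne_zero (hα0 j k l hjk hjl hkl) (hα0 j k i hjk hij.symm hik.symm))
  apply mul_left_cancel₀ hne
  calc (α j k l * α j k i) ^ 2 * (α i j k * α i k j)
      = α j k i ^ 2 * ((α i k j * α j k l) * (α i j k * α j k l)) := by ring
    _ = (α j k i * α j i l) * (α j k i * α k i l) * (α i l j * α i l k) := by
      rw [h₁, h₂]; ring
    _ = α j k l ^ 2 * ((α k l i * α i l j) * (α j l i * α i l k)) := by rw [h₅, h₆]; ring
    _ = (α j k l * α j k i) ^ 2 * (α l j k * α l k j) := by rw [← h₃, ← h₄]; ring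

/-- If two edges `x = c i j`, `y = c i k` have the squares forced by the triangle `i j k`, then
the third edge can be chosen so that the factorization holds on that triangle. -/
theorem triangle_factorization {a b d x y : ℂ} (ha : a ≠ 0) (hx0 : x ≠ 0) (hy0 : y ≠ 0)
    (hx : x ^ 2 = b * d) (hy : y ^ 2 = a * d) :
    a = y * (a * x / y) / x ∧ b = x * (a * x / y) / y ∧ d = x * y / (a * x / y) := by
  refine ⟨by field_simp, ?_, ?_⟩
  · field_simp
    linear_combination b * hy - a * hx
  · field_simp
    linear_combination -hy

theorem exists_factorization (hα : ∀ i j k, α i j k = α j i k)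
    (hα0 : ∀ i j k : Fin 4, i ≠ j → i ≠ k → j ≠ k → α i j k ≠ 0)
    (hmul : ∀ i j k l : Fin 4, i ≠ j → i ≠ k → i ≠ l → j ≠ k → j ≠ l → k ≠ l →
      α i j k * α i k l = α i j l * α j l k) :
    ∃ c : Fin 4 → Fin 4 → ℂ, (∀ i j, c i j = c j i) ∧ (∀ i j, i ≠ j → c i j ≠ 0) ∧
      ∀ i j k : Fin 4, i ≠ j → i ≠ k → j ≠ k → α i j k = c i k * c j k / c i j := by
  have h012 : α 0 1 2 ≠ 0 := hα0 0 1 2 (by decide) (by decide) (by decide)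
  have h021 : α 0 2 1 ≠ 0 := hα0 0 2 1 (by decide) (by decide) (by decide)
  have h120 : α 1 2 0 ≠ 0 := hα0 1 2 0 (by decide) (by decide) (by decide)
  have h013 : α 0 1 3 ≠ 0 := hα0 0 1 3 (by decide) (by decide) (by decide)
  have h130 : α 1 3 0 ≠ 0 := hα0 1 3 0 (by decide) (by decide) (by decide)
  have h023 : α 0 2 3 ≠ 0 := hα0 0 2 3 (by decide) (by decide) (by decide)
  obtain ⟨p, hp⟩ := IsAlgClosed.exists_pow_nat_eq (α 0 2 1 * α 1 2 0) two_pos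
  obtain ⟨q, hq⟩ := IsAlgClosed.exists_pow_nat_eq (α 0 1 2 * α 1 2 0) two_pos
  obtain ⟨r, hr⟩ := IsAlgClosed.exists_pow_nat_eq (α 0 1 3 * α 1 3 0) two_pos
  have hp0 : p ≠ 0 := by rintro rfl; simp_all
  have hq0 : q ≠ 0 := by rintro rfl; simp_all
  have hr0 : r ≠ 0 := by rintro rfl; simp_all
  have hp' : p ^ 2 = α 0 3 1 * α 1 3 0 := by
    have := edge_sq_eq hα hα0 hmul (i := 2) (j := 0) (k := 1) (l := 3)
      (by decide) (by decide) (by decide) (by decide) (by decide) (by decide)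
    rw [hp]; simpa only [hα 2 0, hα 2 1, hα 3 0, hα 3 1] using this
  have hq' : q ^ 2 = α 0 3 2 * α 2 3 0 := by
    have := edge_sq_eq hα hα0 hmul (i := 1) (j := 0) (k := 2) (l := 3)
      (by decide) (by decide) (by decide) (by decide) (by decide) (by decide)
    rw [hq]; simpa only [hα 1 0, hα 3 0, hα 3 2] using this
  have hr' : r ^ 2 = α 0 2 3 * α 2 3 0 := by
    have := edge_sq_eq hα hα0 hmul (i := 1) (j := 0) (k := 3) (l := 2)
      (by decide) (by decide) (by decide) (by decide) (by decide) (by decide)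
    rw [hr]; simpa only [hα 1 0, hα 2 0] using this
  obtain ⟨t₁, t₂, t₃⟩ := triangle_factorization h012 hp0 hq0 hp hq
  obtain ⟨t₄, t₅, t₆⟩ := triangle_factorization h013 hp0 hr0 hp' hr
  obtain ⟨t₇, t₈, t₉⟩ := triangle_factorization h023 hq0 hr0 hq' hr'
  have m₁ : α 1 2 3 * α 1 3 0 = α 1 2 0 * α 0 2 3 := by
    rw [hα 0 2 3]
    exact hmul 1 2 3 0 (by decide) (by decide) (by decide) (by decide) (by decide) (by decide)
  have m₂ : α 0 1 2 * α 0 2 3 = α 0 1 3 * α 1 3 2 :=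
    hmul 0 1 2 3 (by decide) (by decide) (by decide) (by decide) (by decide) (by decide)
  have m₃ : α 0 2 1 * α 0 1 3 = α 0 2 3 * α 2 3 1 :=
    hmul 0 2 1 3 (by decide) (by decide) (by decide) (by decide) (by decide) (by decide)
  set s := α 0 1 2 * p / q with hs
  set t := α 0 1 3 * p / r with ht
  set w := α 0 2 3 * q / r with hw
  have hs0 : s ≠ 0 := div_ne_zero (mul_ne_zero h012 hp0) hq0
  have ht0 : t ≠ 0 := div_ne_zero (mul_ne_zero h013 hp0) hr0
  have hw0 : w ≠ 0 := div_ne_zero (mul_ne_zero h023 hq0) hr0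
  have t₁₀ : α 1 2 3 = t * w / s := by
    rw [hs, ht, hw]
    field_simp
    apply mul_left_cancel₀ h130
    linear_combination r ^ 2 * α 0 1 2 * m₁ + α 0 1 2 * α 1 2 0 * α 0 2 3 * hr
      - α 0 1 3 * α 1 3 0 * α 0 2 3 * hq
  have t₁₁ : α 1 3 2 = s * w / t := by
    rw [hs, ht, hw]
    field_simp
    linear_combination -m₂
  have t₁₂ : α 2 3 1 = s * t / w := by
    rw [hs, ht, hw]
    field_simp
    apply mul_left_cancel₀ h120
    linear_combination -q ^ 2 * α 1 2 0 * m₃ + α 0 2 1 * α 1 2 0 * α 0 1 3 * hq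
      - α 0 1 2 * α 1 2 0 * α 0 1 3 * hp
  refine ⟨!![0, p, q, r; p, 0, s, t; q, s, 0, w; r, t, w, 0], ?_, ?_, ?_⟩
  · intro i j
    fin_cases i <;> fin_cases j <;> rfl
  · intro i j hij
    fin_cases i <;> fin_cases j <;> first | exact absurd rfl hij | assumption
  · intro i j k hij hik hjk
    fin_cases i <;> fin_cases j <;> first
      | exact absurd rfl hij
      | (fin_cases k <;> first
          | exact absurd rfl hik
          | exact absurd rfl hjk
          | assumption
          | (rw [hα, mul_comm]; assumption))

end Factorization

theorem stmt_4 (α β lam μ : Fin 4 → Fin 4 → Fin 4 → ℂ)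
    (hα : ∀ i j k, α i j k = α j i k)
    (hα0 : ∀ i j k : Fin 4, i ≠ j → i ≠ k → j ≠ k → α i j k ≠ 0)
    (hlam : ∀ i j k : Fin 4, i ≠ j → i ≠ k → j ≠ k → lam i j k = 0) :
    SystemA2 (quadA α β lam μ) ↔
      ((∀ i j k : Fin 4, i ≠ j → i ≠ k → j ≠ k →
          β i j k = 0 ∧ β j i k = 0 ∧ μ i j k = 0 ∧ μ j i k = 0) ∧
        ∃ c : Fin 4 → Fin 4 → ℂ, (∀ i j, c i j = c j i) ∧ (∀ i j, i ≠ j → c i j ≠ 0) ∧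
          ∀ i j k : Fin 4, i ≠ j → i ≠ k → j ≠ k →
            α i j k = c i k * c j k / c i j) := by
  constructor
  · intro h
    exact ⟨fun i j k hij hik hjk =>
      ⟨beta_eq_zero_of_systemA2 hα hα0 hlam h hij hik hjk,
        beta_eq_zero_of_systemA2 hα hα0 hlam h hij.symm hjk hik,
        mu_eq_zero_of_systemA2 hα hα0 hlam h hij hik hjk,
        mu_eq_zero_of_systemA2 hα hα0 hlam h hij.symm hjk hik⟩,
      exists_factorization hα hα0 fun _ _ _ _ hij hik hil hjk hjl hkl =>
        alpha_mul_eq_of_systemA2 hα hlam h hij hik hil hjk hjl hkl⟩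
  · rintro ⟨hβμ, c, hc, hc0, hαc⟩ i j k l huniv
    obtain ⟨hij, hik, hil, hjk, hjl, hkl⟩ := (insert_eq_univ_iff i j k l).1 huniv
    have hquad : ∀ {p q r : Fin 4}, p ≠ q → p ≠ r → q ≠ r →
        quadA α β lam μ p q r = C (α p q r) * xv p r * xv q r := by
      intro p q r hpq hpr hqr
      obtain ⟨h₁, h₂, h₃, h₄⟩ := hβμ p q r hpq hpr hqr
      simp [quadA, h₁, h₂, h₃, h₄, hlam p q r hpq hpr hqr]
    have hlam' : ∀ {p q r : Fin 4}, p ≠ q → p ≠ r → q ≠ r → lam p q r = lam q p r :=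
      fun hpq hpr hqr => by rw [hlam _ _ _ hpq hpr hqr, hlam _ _ _ hpq.symm hqr hpr]
    have hmul : ∀ {i j k l : Fin 4}, i ≠ j → i ≠ k → i ≠ l → j ≠ k → j ≠ l → k ≠ l →
        C (σ := Fin 4 × Fin 4) (α i j k) * C (α i k l) = C (α i j l) * C (α j l k) := by
      intro i j k l hij hik hil hjk hjl hkl
      have h₁ := hc0 i j hij
      have h₂ := hc0 i k hik
      have h₃ := hc0 j l hjl
      rw [← C_mul, ← C_mul, hαc i j k hij hik hjk, hαc i k l hik hil hkl,
        hαc i j l hij hil hjl, hαc j l k hjl hjk hkl.symm, hc l k]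
      congr 1
      field_simp
    obtain ⟨k₁, k₂, k₃, k₄⟩ := hβμ i j k hij hik hjk
    obtain ⟨l₁, l₂, l₃, l₄⟩ := hβμ i j l hij hil hjl
    rw [pderiv_quadA_base α β lam μ hik hjk (hlam _ _ _ hij hik hjk),
      pderiv_quadA_base α β lam μ hil hjl (hlam _ _ _ hij hil hjl),
      pderiv_quadA_left α β lam μ hij hjk, pderiv_quadA_left α β lam μ hij hjl,
      pderiv_quadA_right α β lam μ hij hik (hα _ _ _) (hlam' hij hik hjk),
      pderiv_quadA_right α β lam μ hij hil (hα _ _ _) (hlam' hij hil hjl),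
      hquad hij hik hjk, hquad hij hil hjl, hquad hik hil hkl, hquad hjk hjl hkl,
      hquad hil hik hkl.symm, hquad hjl hjk hkl.symm, k₁, k₂, k₃, k₄, l₁, l₂, l₃, l₄, xv_comm l k]
    simp only [C_0]
    have e₁ := hmul hij hik hil hjk hjl hkl
    have e₂ := hmul hij.symm hjk hjl hik hil hkl
    rw [hα j i k, hα j i l] at e₂
    linear_combination xv j k * xv i l * xv k l * e₁ + xv i k * xv j l * xv k l * e₂

end
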